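/- If F is an IFS on a compact metric space, A is a Conley attractor of F, and N is any neighborhood of A, then there exists an attractor block Q for A contained in N, i.e., an open set Q ⊆ N with A ⊆ Q, F(closure Q) ⊆ Q, and A = lim_{k→∞} F^k(closure Q). -/

import Mathlib

open Set Filter Metric Topology

/-- The set map of an IFS: `F(S) = ⋃ i, fᵢ(S)`. -/
def IFSApply {ι X : Type*} (f : ι → X → X) (S : Set X) : Set X := ⋃ i, f i '' S

/-- `lim_{k→∞} F^k(closure U) = A` in the Hausdorff (extended) metric. -/
def ConleyLim {ι X : Type*} [MetricSpace X] (f : ι → X → X) (U A : Set X) : Prop :=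
  Filter.Tendsto (fun k => EMetric.hausdorffEdist ((IFSApply f)^[k] (closure U)) A)
    Filter.atTop (nhds 0)

/-- A compact set `A` is a Conley attractor of the IFS `f` if there is an open `U ⊇ A`
with `A = lim_{k→∞} F^k(closure U)`. -/
def IsConleyAttractor {ι X : Type*} [MetricSpace X] (f : ι → X → X) (A : Set X) : Prop :=
  IsCompact A ∧ ∃ U : Set X, IsOpen U ∧ A ⊆ U ∧ ConleyLim f U A

/-- The basin of a Conley attractor: the union of all open sets `U` as in the definition. -/
def conleyBasin {ι X : Type*} [MetricSpace X] (f : ι → X → X) (A : Set X) : Set X :=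
  ⋃₀ {U : Set X | IsOpen U ∧ A ⊆ U ∧ ConleyLim f U A}

/-- `lim_{k→∞} F^k(S) = A` in the Hausdorff (extended) metric. -/
def IFSLim {ι X : Type*} [MetricSpace X] (f : ι → X → X) (S A : Set X) : Prop :=
  Filter.Tendsto (fun k => EMetric.hausdorffEdist ((IFSApply f)^[k] S) A)
    Filter.atTop (nhds 0)

/-- `A` is a strict attractor of the IFS `f`. -/
def IsStrictAttractor {ι X : Type*} [MetricSpace X] (f : ι → X → X) (A : Set X) : Prop :=
  A.Nonempty ∧ IsCompact A ∧ IFSApply f A = A ∧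
  ∃ U : Set X, IsOpen U ∧ A ⊆ U ∧
    ∀ S : Set X, S.Nonempty → IsCompact S → S ⊆ U → IFSLim f S A

/-- The basin of a strict attractor: the largest open `U` with
`lim_{k→∞} F^k(S) = A` for all nonempty compact `S ⊆ U`. -/
def strictBasin {ι X : Type*} [MetricSpace X] (f : ι → X → X) (A : Set X) : Set X :=
  ⋃₀ {U : Set X | IsOpen U ∧
    ∀ S : Set X, S.Nonempty → IsCompact S → S ⊆ U → IFSLim f S A}

/-- The points that every map of the IFS sends into `V`. -/
def IFSPreimage {ι X : Type*} (f : ι → X → X) (V : Set X) : Set X := ⋂ i, f i ⁻¹' V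

section IFS

variable {ι X : Type*} {f : ι → X → X}

lemma gc_IFSApply_IFSPreimage (f : ι → X → X) :
    GaloisConnection (IFSApply f) (IFSPreimage f) := by
  intro S V
  simp [IFSApply, IFSPreimage, image_subset_iff]

lemma gc_IFSApply_IFSPreimage_iterate (f : ι → X → X) (k : ℕ) :
    GaloisConnection (IFSApply f)^[k] (IFSPreimage f)^[k] := by
  induction k with
  | zero => exact GaloisConnection.id
  | succ k ih =>
    rw [Function.iterate_succ, Function.iterate_succ']
    exact (gc_IFSApply_IFSPreimage f).compose ih

lemma isOpen_IFSPreimage_iterate [TopologicalSpace X] [Finite ι] (hf : ∀ i, Continuous (f i))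
    {V : Set X} (hV : IsOpen V) (k : ℕ) : IsOpen ((IFSPreimage f)^[k] V) := by
  induction k with
  | zero => exact hV
  | succ k ih =>
    rw [Function.iterate_succ_apply']
    exact isOpen_iInter_of_finite fun i => ih.preimage (hf i)

lemma isClosed_IFSPreimage_iterate [TopologicalSpace X] (hf : ∀ i, Continuous (f i))
    {V : Set X} (hV : IsClosed V) (k : ℕ) : IsClosed ((IFSPreimage f)^[k] V) := by
  induction k with
  | zero => exact hV
  | succ k ih =>
    rw [Function.iterate_succ_apply']
    exact isClosed_iInter fun i => ih.preimage (hf i)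

lemma closure_IFSPreimage_iterate_subset [TopologicalSpace X] (hf : ∀ i, Continuous (f i))
    {V W : Set X} (h : closure V ⊆ W) (k : ℕ) :
    closure ((IFSPreimage f)^[k] V) ⊆ (IFSPreimage f)^[k] W :=
  (closure_minimal ((gc_IFSApply_IFSPreimage_iterate f k).monotone_u subset_closure)
    (isClosed_IFSPreimage_iterate hf isClosed_closure k)).trans
    ((gc_IFSApply_IFSPreimage_iterate f k).monotone_u h)

lemma isCompact_IFSApply [TopologicalSpace X] [Finite ι] (hf : ∀ i, Continuous (f i))
    {A : Set X} (hA : IsCompact A) : IsCompact (IFSApply f A) :=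
  isCompact_iUnion fun i => hA.image (hf i)

lemma exists_hausdorffEDist_IFSApply_le [MetricSpace X] [CompactSpace X] [Fintype ι]
    (hf : ∀ i, Continuous (f i)) {ε : ENNReal} (hε : 0 < ε) :
    ∃ δ > 0, ∀ S T : Set X, hausdorffEDist S T < δ →
      hausdorffEDist (IFSApply f S) (IFSApply f T) ≤ ε := by
  have hu : UniformContinuous fun x i => f i x :=
    uniformContinuous_pi.2 fun i => CompactSpace.uniformContinuous_of_continuous (hf i)
  obtain ⟨δ, hδ, h⟩ := EMetric.uniformContinuous_iff.1 hu ε hε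
  have hle {x y : X} (hxy : edist x y < δ) (i : ι) : edist (f i x) (f i y) ≤ ε :=
    (edist_le_pi_edist (fun i => f i x) (fun i => f i y) i).trans (h hxy).le
  have key (S T : Set X) (hST : hausdorffEDist S T < δ) :
      ∀ x ∈ IFSApply f S, ∃ y ∈ IFSApply f T, edist x y ≤ ε := by
    intro x hx
    obtain ⟨i, s, hs, rfl⟩ := mem_iUnion.1 hx
    obtain ⟨t, ht, hst⟩ := exists_edist_lt_of_hausdorffEDist_lt hs hST
    exact ⟨f i t, mem_iUnion.2 ⟨i, t, ht, rfl⟩, hle hst i⟩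
  exact ⟨δ, hδ, fun S T hST => hausdorffEDist_le_of_mem_edist (key S T hST)
    (key T S (by rwa [hausdorffEDist_comm]))⟩

lemma tendsto_hausdorffEDist_IFSApply [MetricSpace X] [CompactSpace X] [Fintype ι]
    (hf : ∀ i, Continuous (f i)) {S : ℕ → Set X} {A : Set X}
    (h : Tendsto (fun k => hausdorffEDist (S k) A) atTop (𝓝 0)) :
    Tendsto (fun k => hausdorffEDist (IFSApply f (S k)) (IFSApply f A)) atTop (𝓝 0) := by
  rw [ENNReal.tendsto_nhds_zero]
  intro ε hε
  obtain ⟨δ, hδ, hd⟩ := exists_hausdorffEDist_IFSApply_le hf hε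
  filter_upwards [h.eventually_lt_const hδ] with k hk using hd _ _ hk

/-- A compact Hausdorff limit of the iterates of an IFS is invariant. -/
lemma IFSLim.IFSApply_eq [MetricSpace X] [CompactSpace X] [Fintype ι]
    (hf : ∀ i, Continuous (f i)) {S A : Set X} (hA : IsCompact A) (h : IFSLim f S A) :
    IFSApply f A = A := by
  have h1 := tendsto_hausdorffEDist_IFSApply hf h
  have h2 : Tendsto (fun k => hausdorffEDist (IFSApply f ((IFSApply f)^[k] S)) A)
      atTop (𝓝 0) := by
    simpa only [Function.iterate_succ_apply'] using
      (tendsto_add_atTop_iff_nat (f := fun k => hausdorffEDist ((IFSApply f)^[k] S) A) 1).2 h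
  refine ((isCompact_IFSApply hf hA).isClosed.hausdorffEDist_zero_iff hA.isClosed).1 ?_
  refine le_antisymm (ge_of_tendsto' (by simpa using h1.add h2) fun k => ?_) zero_le
  rw [hausdorffEDist_comm (s := IFSApply f ((IFSApply f)^[k] S)) (t := IFSApply f A)]
  exact hausdorffEDist_triangle

/-- A set squeezed between an invariant Hausdorff limit and a set attracted to it is attracted. -/
lemma IFSLim.mono [MetricSpace X] {S T A : Set X} (h : IFSLim f S A)
    (hA : IFSApply f A = A) (hAT : A ⊆ T) (hTS : T ⊆ S) : IFSLim f T A := by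
  refine tendsto_of_tendsto_of_tendsto_of_le_of_le tendsto_const_nhds h
    (fun _ => zero_le) fun k => ?_
  have hmono := (gc_IFSApply_IFSPreimage_iterate f k).monotone_l
  have hAk : A ⊆ (IFSApply f)^[k] T := by
    have := hmono hAT
    rwa [Function.iterate_fixed hA] at this
  refine hausdorffEDist_le_of_infEDist
    (fun x hx => infEDist_le_hausdorffEDist_of_mem (hmono hTS hx)) fun x hx => ?_
  rw [infEDist_zero_of_mem (hAk hx)]
  exact zero_le

lemma IFSLim.eventually_subset_thickening [MetricSpace X] {S A : Set X} (h : IFSLim f S A)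
    {δ : ℝ} (hδ : 0 < δ) : ∀ᶠ k in atTop, (IFSApply f)^[k] S ⊆ thickening δ A := by
  filter_upwards [h.eventually_lt_const (ENNReal.ofReal_pos.2 hδ)] with k hk x hx
  exact (infEDist_le_hausdorffEDist_of_mem hx).trans_lt hk

end IFS

theorem exists_attractor_block {ι X : Type*} [MetricSpace X] [CompactSpace X]
    [Fintype ι] [Nonempty ι] (f : ι → X → X) (hf : ∀ i, Continuous (f i))
    (A : Set X) (hA : IsConleyAttractor f A)
    (N : Set X) (hN : N ∈ nhdsSet A) :
    ∃ Q : Set X, IsOpen Q ∧ Q ⊆ N ∧ A ⊆ Q ∧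
      IFSApply f (closure Q) ⊆ Q ∧ ConleyLim f Q A := by
  obtain ⟨hAc, U, hUo, hAU, hU⟩ := hA
  have hlim : IFSLim f (closure U) A := hU
  have hinv := hlim.IFSApply_eq hf hAc
  obtain ⟨δ, hδ, hδU⟩ := hAc.exists_thickening_subset_open (hUo.inter isOpen_interior)
    (subset_inter hAU (subset_interior_iff_mem_nhdsSet.2 hN))
  obtain ⟨m, hm⟩ := (hlim.eventually_subset_thickening (half_pos hδ)).exists_forall_of_atTop
  -- A decreasing sequence of neighbourhoods, so that `F (closure Q)` stays strictly inside `Q`.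
  let r (j : ℕ) : ℝ := δ / 2 * (1 + 1 / (j + 1))
  let V (j : ℕ) : Set X := thickening (r j) A
  have hr (j : ℕ) : δ / 2 < r j :=
    lt_mul_of_one_lt_right (half_pos hδ) (lt_add_of_pos_right _ Nat.one_div_pos_of_nat)
  have hrpos (j : ℕ) : 0 < r j := (half_pos hδ).trans (hr j)
  have hVo (j : ℕ) : IsOpen (V j) := isOpen_thickening
  have hV (j : ℕ) : closure (V (j + 1)) ⊆ V j := by
    refine (closure_thickening_subset_cthickening _ _).trans
      (cthickening_subset_thickening' (hrpos j) ?_ A)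
    exact mul_lt_mul_of_pos_left (add_lt_add_right (Nat.one_div_lt_one_div (Nat.lt_succ_self j)) _)
      (half_pos hδ)
  have hV0 : V 0 ⊆ U ∩ interior N := by
    have : r 0 = δ := by simp [r]; ring
    simpa only [V, this] using hδU
  let Q : Set X := ⋂ j ∈ Iic m, (IFSPreimage f)^[j] (V j)
  have hQ0 : Q ⊆ V 0 := biInter_subset_of_mem (mem_Iic.2 (Nat.zero_le m))
  have hQU : closure Q ⊆ closure U := closure_mono ((hQ0.trans hV0).trans inter_subset_left)
  have hAQ : A ⊆ Q := subset_iInter₂ fun j _ => by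
    refine (gc_IFSApply_IFSPreimage_iterate f j _ _).1 ?_
    rw [Function.iterate_fixed hinv]
    exact self_subset_thickening (hrpos j) A
  refine ⟨Q, (finite_Iic m).isOpen_biInter fun j _ => isOpen_IFSPreimage_iterate hf (hVo j) j,
    (hQ0.trans hV0).trans (inter_subset_right.trans interior_subset), hAQ, ?_,
    hlim.mono hinv (hAQ.trans subset_closure) hQU⟩
  refine subset_iInter₂ fun j hj => ?_
  refine (gc_IFSApply_IFSPreimage_iterate f j _ _).1 ?_
  rw [← Function.iterate_succ_apply]
  rcases (mem_Iic.1 hj).lt_or_eq with h | rfl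
  · refine (gc_IFSApply_IFSPreimage_iterate f (j + 1) _ _).2 ?_
    exact (closure_mono (biInter_subset_of_mem (mem_Iic.2 (Nat.succ_le_of_lt h)))).trans
      (closure_IFSPreimage_iterate_subset hf (hV j) (j + 1))
  · exact ((gc_IFSApply_IFSPreimage_iterate f (j + 1)).monotone_l hQU).trans
      ((hm (j + 1) (Nat.le_succ j)).trans (thickening_mono (hr j).le A))
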